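/- Let H be an infinite-dimensional separable Hilbert space over ℂ and let T : H → H be an injective bounded linear operator such that the only closed subspaces of H invariant under T are {0} and H. Let x ∈ H be nonzero, let (θ_n)_{n=1}^∞ be an orthonormal sequence in H with span{θ_1,…,θ_n} = span{T(x),…,Tⁿ(x)} for each n ∈ ℕ, and for each n define x_n = x − Σ_{j=1}^n ⟨x, θ_j⟩ θ_j, assumed nonzero, and y_n = x_n/‖x_n‖. Then the sequence (y_n)_{n=1}^∞ converges weakly to zero, i.e., lim_{n→∞} ⟨x', y_n⟩ = 0 for every x' ∈ H; consequently, every subsequence of (y_n)_{n=1}^∞ converges weakly to zero. -/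

import Mathlib

open scoped ComplexInnerProductSpace
open Filter Topology

/-- A bounded sequence whose inner products with the elements of a total set tend to zero
converges weakly to zero. -/
theorem tendsto_inner_zero_of_dense_span {𝕜 E : Type*} [RCLike 𝕜] [NormedAddCommGroup E]
    [InnerProductSpace 𝕜 E] {s : Set E} (hs : (Submodule.span 𝕜 s).topologicalClosure = ⊤)
    {y : ℕ → E} {C : ℝ} (hy : ∀ n, ‖y n‖ ≤ C)
    (h : ∀ v ∈ s, Tendsto (fun n => inner 𝕜 v (y n)) atTop (𝓝 0)) (v : E) :
    Tendsto (fun n => inner 𝕜 v (y n)) atTop (𝓝 0) := by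
  have h_span : ∀ w ∈ Submodule.span 𝕜 s,
      Tendsto (fun n => inner 𝕜 w (y n)) atTop (𝓝 0) := by
    intro w hw
    induction hw using Submodule.span_induction with
    | mem w hw => exact h w hw
    | zero => simp
    | add u w _ _ hu hw => simpa [inner_add_left] using hu.add hw
    | smul a w _ hw => simpa [inner_smul_left] using hw.const_mul ((starRingEnd 𝕜) a)
  have hC : 0 ≤ C := (norm_nonneg _).trans (hy 0)
  have hv : v ∈ closure (Submodule.span 𝕜 s : Set E) := by
    rw [← Submodule.topologicalClosure_coe, hs]
    trivial
  rw [Metric.tendsto_atTop]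
  intro ε hε
  obtain ⟨w, hw, hvw⟩ := Metric.mem_closure_iff.1 hv (ε / 2 / (C + 1)) (by positivity)
  obtain ⟨N, hN⟩ := Metric.tendsto_atTop.1 (h_span w hw) (ε / 2) (by positivity)
  refine ⟨N, fun n hn => ?_⟩
  have h1 := hN n hn
  rw [dist_zero_right] at h1 ⊢
  have h2 : ‖inner 𝕜 (v - w) (y n)‖ ≤ ε / 2 := by
    rw [dist_eq_norm, lt_div_iff₀ (by positivity)] at hvw
    calc ‖inner 𝕜 (v - w) (y n)‖ ≤ ‖v - w‖ * ‖y n‖ := norm_inner_le_norm _ _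
      _ ≤ ‖v - w‖ * (C + 1) := by gcongr; linarith [hy n]
      _ ≤ ε / 2 := hvw.le
  calc ‖inner 𝕜 v (y n)‖ = ‖inner 𝕜 (v - w) (y n) + inner 𝕜 w (y n)‖ := by
        rw [← inner_add_left, sub_add_cancel]
    _ ≤ ‖inner 𝕜 (v - w) (y n)‖ + ‖inner 𝕜 w (y n)‖ := norm_add_le _ _
    _ < ε := by linarith

/-- If `T` is injective and has no nontrivial closed invariant subspace, then the vectors
`T x, T² x, …` span a dense subspace whenever `x ≠ 0`. -/
theorem topologicalClosure_span_pow_succ_eq_top {𝕜 E : Type*} [RCLike 𝕜]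
    [NormedAddCommGroup E] [NormedSpace 𝕜 E] {T : E →L[𝕜] E} (hT : Function.Injective T)
    (hinv : ∀ S : Submodule 𝕜 E, IsClosed (S : Set E) → (∀ x ∈ S, T x ∈ S) → S = ⊥ ∨ S = ⊤)
    {x : E} (hx : x ≠ 0) :
    (Submodule.span 𝕜 (Set.range fun j : ℕ => (T ^ (j + 1)) x)).topologicalClosure = ⊤ := by
  set S := Submodule.span 𝕜 (Set.range fun j : ℕ => (T ^ (j + 1)) x)
  have h_map : ∀ v ∈ S, T v ∈ S := by
    intro v hv
    induction hv using Submodule.span_induction with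
    | mem v hv =>
      obtain ⟨j, rfl⟩ := hv
      refine Submodule.subset_span ⟨j + 1, ?_⟩
      simp only [pow_succ' T (j + 1), mul_apply_eq_comp]
    | zero => simp
    | add u v _ _ hu hv => simpa using S.add_mem hu hv
    | smul a v _ hv => simpa using S.smul_mem a hv
  refine (hinv S.topologicalClosure S.isClosed_topologicalClosure fun v hv =>
    map_mem_closure T.continuous hv h_map).resolve_left fun h_bot => ?_
  have hTx : T x ∈ S.topologicalClosure :=
    S.le_topologicalClosure (Submodule.subset_span ⟨0, by simp⟩)
  rw [h_bot, Submodule.mem_bot] at hTx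
  exact hx (hT (by rw [hTx, map_zero]))

/-- With `T` an injective bounded linear operator on an infinite-dimensional separable complex
Hilbert space whose only closed invariant subspaces are `{0}` and `H`, `x ≠ 0`, `θ` an
orthonormal sequence with `span {θ_0, …, θ_{n-1}} = span {T x, …, Tⁿ x}` for all `n`,
`xs n = x - Σ_{j ≤ n} ⟨x, θ j⟩ θ j` assumed nonzero, and `y n = xs n / ‖xs n‖`, the sequence
`y` converges weakly to zero, and hence so does every subsequence of `y`. -/
theorem stmt_15 {H : Type*} [NormedAddCommGroup H] [InnerProductSpace ℂ H] [CompleteSpace H]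
    [TopologicalSpace.SeparableSpace H] (hinf : ¬ FiniteDimensional ℂ H)
    (T : H →L[ℂ] H) (hTinj : Function.Injective T)
    (hinv : ∀ S : Submodule ℂ H, IsClosed (S : Set H) → (∀ x ∈ S, T x ∈ S) → S = ⊥ ∨ S = ⊤)
    (x : H) (hx : x ≠ 0) (θ : ℕ → H) (hθ : Orthonormal ℂ θ)
    (hspan : ∀ n : ℕ, Submodule.span ℂ (θ '' Set.Iio n)
      = Submodule.span ℂ ((fun j : ℕ => (T ^ (j + 1)) x) '' Set.Iio n))
    (xs : ℕ → H) (hxs : ∀ n : ℕ, xs n = x - ∑ j ∈ Finset.range (n + 1), ⟪θ j, x⟫ • θ j)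
    (hxs0 : ∀ n : ℕ, xs n ≠ 0)
    (y : ℕ → H) (hy : ∀ n : ℕ, y n = ‖xs n‖⁻¹ • xs n) :
    (∀ x' : H, Filter.Tendsto (fun n => ⟪x', y n⟫) Filter.atTop (nhds 0)) ∧
      ∀ k : ℕ → ℕ, StrictMono k →
        ∀ x' : H, Filter.Tendsto (fun n => ⟪x', y (k n)⟫) Filter.atTop (nhds 0) := by
  have h_total : (Submodule.span ℂ (Set.range θ)).topologicalClosure = ⊤ := by
    rw [eq_top_iff, ← topologicalClosure_span_pow_succ_eq_top hTinj hinv hx]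
    refine Submodule.topologicalClosure_mono (Submodule.span_le.2 ?_)
    rintro _ ⟨j, rfl⟩
    refine Submodule.span_mono (Set.image_subset_range θ (Set.Iio (j + 1))) ?_
    rw [hspan]
    exact Submodule.subset_span ⟨j, Nat.lt_succ_self j, rfl⟩
  have h_norm : ∀ n, ‖y n‖ ≤ 1 := fun n => by
    rw [hy, norm_smul, norm_inv, norm_norm, inv_mul_cancel₀ (norm_ne_zero_iff.2 (hxs0 n))]
  have h_orth : ∀ j n, j ≤ n → ⟪θ j, y n⟫ = 0 := fun j n hjn => by
    have h_zero : ⟪θ j, xs n⟫ = 0 := by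
      rw [hxs, inner_sub_right, hθ.inner_right_sum _ (Finset.mem_range.2 (Nat.lt_succ_of_le hjn)),
        sub_self]
    rw [hy, inner_smul_right_eq_smul, h_zero, smul_zero]
  have h_weak : ∀ x' : H, Tendsto (fun n => ⟪x', y n⟫) atTop (𝓝 0) := by
    refine tendsto_inner_zero_of_dense_span h_total h_norm ?_
    rintro _ ⟨j, rfl⟩
    refine tendsto_const_nhds.congr' ?_
    filter_upwards [eventually_ge_atTop j] with n hn using (h_orth j n hn).symm
  exact ⟨h_weak, fun k hk x' => (h_weak x').comp hk.tendsto_atTop⟩
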